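/- arXiv:2604.26163 — 2 statements merged into one kernel-verified Lean document; each statement's English description precedes it below -/
import Mathlib

section
/- Let λ1 ≤ λ2 ≤ λ3 ≤ λ4 be real numbers with λ1 + λ2 + λ3 + λ4 = 1 and λ1² + λ2² + λ3² + λ4² = 1/2. Then λ1 + λ2 ≥ 0. -/
theorem stmt_0 (l1 l2 l3 l4 : ℝ)
    (h12 : l1 ≤ l2) (h23 : l2 ≤ l3) (h34 : l3 ≤ l4)
    (hsum : l1 + l2 + l3 + l4 = 1)
    (hsq : l1^2 + l2^2 + l3^2 + l4^2 = 1/2) :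
    0 ≤ l1 + l2 := by
  by_contra h
  have h1 : 1 < l3 + l4 := by linarith
  nlinarith [sq_nonneg (l3 - l4), sq_nonneg l1, sq_nonneg l2, mul_pos (sub_pos.2 h1) (sub_pos.2 h1)]
end

section
/- Let λ1, λ2, λ3, λ4 and K12, K23, K24, K34 be real numbers satisfying: 0 ≤ λ1 ≤ λ2 ≤ λ3 ≤ λ4, λ1 + λ2 + λ3 + λ4 = 1, λ1² + λ2² + λ3² + λ4² = 1/2, λ1 + λ2 ≤ 1/200, |K12| ≤ 1/200, |K23| ≤ 1/200, |K24| ≤ 1/200, and 2·K34 = 2·K12 + 1 − 2(λ1 + λ2). Then 4·K23·λ2·λ3 + 4·K24·λ2·λ4 + 4·K34·λ3·λ4 − 1/2 ≤ −(9/10)(λ1 + λ2) + K12. -/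
theorem stmt_5 (l1 l2 l3 l4 K12 K23 K24 K34 : ℝ)
    (h01 : 0 ≤ l1) (h12 : l1 ≤ l2) (h23 : l2 ≤ l3) (h34 : l3 ≤ l4)
    (hsum : l1 + l2 + l3 + l4 = 1)
    (hsq : l1^2 + l2^2 + l3^2 + l4^2 = 1/2)
    (hsmall : l1 + l2 ≤ 1/200)
    (hK12 : |K12| ≤ 1/200) (hK23 : |K23| ≤ 1/200) (hK24 : |K24| ≤ 1/200)
    (hK34 : 2 * K34 = 2 * K12 + 1 - 2 * (l1 + l2)) :
    4 * K23 * l2 * l3 + 4 * K24 * l2 * l4 + 4 * K34 * l3 * l4 - 1/2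
      ≤ -(9/10) * (l1 + l2) + K12 := by 
  obtain ⟨a1, a2⟩ := abs_le.mp hK12
  obtain ⟨b1, b2⟩ := abs_le.mp hK23
  obtain ⟨c1, c2⟩ := abs_le.mp hK24
  obtain ⟨s, hs⟩ : ∃ s, s = l1 + l2 := ⟨_, rfl⟩
  obtain ⟨t, ht⟩ : ∃ t, t = s^2 + l1^2 + l2^2 := ⟨_, rfl⟩
  have s0 : 0 ≤ s := by linarith
  have s1 : s ≤ 1/200 := by linarith
  have t0 : 0 ≤ t := by rw [ht]; positivity
  have t1 : t ≤ s / 100 := by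
    have : t ≤ 2 * s^2 := by
      rw [ht, hs]; linarith [mul_nonneg h01 (h01.trans h12)]
    linarith [mul_le_mul_of_nonneg_right s1 s0]
  have hp : 4 * (l3 * l4) = 1 - 4 * s + 2 * t := by
    have e : l3 + l4 = 1 - s := by linarith
    have e2 : (l3 + l4)^2 = (1 - s)^2 := by rw [e]
    linarith [e2, ht, hsq]
  have hK : K34 = K12 + 1/2 - s := by linarith
  have l20 : 0 ≤ l2 := by linarith
  have u3 : K23 * (l2 * l3) ≤ s / 200 := by
    have x0 : 0 ≤ l2 * l3 := mul_nonneg l20 (by linarith)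
    have x1 : l2 * l3 ≤ s := by
      have := mul_le_mul_of_nonneg_left (show l3 ≤ 1 by linarith) l20
      linarith
    have := mul_le_mul_of_nonneg_right (show K23 ≤ 1/200 by linarith) x0
    linarith
  have u4 : K24 * (l2 * l4) ≤ s / 200 := by
    have x0 : 0 ≤ l2 * l4 := mul_nonneg l20 (by linarith)
    have x1 : l2 * l4 ≤ s := by
      have := mul_le_mul_of_nonneg_left (show l4 ≤ 1 by linarith) l20
      linarith
    have := mul_le_mul_of_nonneg_right (show K24 ≤ 1/200 by linarith) x0
    linarith
  have e : 4 * K34 * l3 * l4 = (K12 + 1/2 - s) * (1 - 4 * s + 2 * t) := by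
    rw [← hp, hK]; ring
  have v1 : -(K12 * s) ≤ s / 200 := by
    linarith [mul_le_mul_of_nonneg_right a1 s0]
  have v2 : K12 * t ≤ t / 200 := by
    linarith [mul_le_mul_of_nonneg_right a2 t0]
  have v3 : s * s ≤ s / 200 := by
    linarith [mul_le_mul_of_nonneg_right s1 s0]
  have v4 : 0 ≤ s * t := mul_nonneg s0 t0
  rw [e, ← hs]
  linarith
end
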